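/- arXiv:2204.06257 — 6 statements merged into one kernel-verified Lean document; each statement's English description precedes it below -/
import Mathlib

section
/- Let δ ∈ (0,1), a > 0, and let p ≥ 1 be an integer. For every s > 0, the p-th derivative of s ↦ e^{−a s^{δ}} equals e^{−a s^{δ}} · (−s)^{−p} · Σ_{n=1}^{p} (δ a s^{δ})^{n} · Υ_{p,n}, where Υ_{p,n} = Σ_{S} ∏_{i=1}^{p−n} [q_i − δ(q_i − i + 1)], the sum running over all subsets S of {1,2,…,p−1} of cardinality p−n with elements q_1 < q_2 < ⋯ < q_{p−n} listed in increasing order, and with the convention Υ_{p,p} = 1. -/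
open Real Finset

/-- `Υ_{p,n} = Σ_{S ⊆ {1,…,p−1}, |S| = p−n} ∏_{i=1}^{p−n} [q_i − δ(q_i − i + 1)]`, where
`q_1 < ⋯ < q_{p−n}` are the elements of `S` in increasing order (here the product is
written with 0-based index `i`, so the factor is `q − δ(q − i)`); `Υ_{p,p} = 1`. -/
noncomputable def upsilon (δ : ℝ) (p n : ℕ) : ℝ :=
  ∑ S ∈ Finset.powersetCard (p - n) (Finset.Icc 1 (p - 1)),
    ∏ i ∈ Finset.range (p - n),
      (((S.sort (· ≤ ·)).getD i 0 : ℝ) - δ * (((S.sort (· ≤ ·)).getD i 0 : ℝ) - (i : ℝ)))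

/-- Inserting a strict upper bound of a finset appends it to the sorted list of elements. -/
lemma sort_insert_of_forall_lt {α : Type*} [LinearOrder α] {S : Finset α} {a : α}
    (h : ∀ b ∈ S, b < a) : (insert a S).sort (· ≤ ·) = S.sort (· ≤ ·) ++ [a] := by
  have ha : a ∉ S := fun h' => lt_irrefl a (h a h')
  have hnd : (S.sort (· ≤ ·) ++ [a]).Nodup := by
    simp [List.nodup_append, ha]
  have hfin : (S.sort (· ≤ ·) ++ [a]).toFinset = insert a S := by
    ext b
    simp
  rw [← hfin, List.toFinset_sort _ hnd, List.pairwise_append]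
  refine ⟨S.pairwise_sort _, by simp, fun b hb c hc => ?_⟩
  rw [List.mem_singleton.1 hc]
  exact (h b ((Finset.mem_sort _).1 hb)).le

lemma upsilon_self (δ : ℝ) (p : ℕ) : upsilon δ p p = 1 := by
  simp [upsilon]

lemma upsilon_succ_zero (δ : ℝ) (p : ℕ) : upsilon δ (p + 1) 0 = 0 := by
  unfold upsilon
  rw [Finset.powersetCard_eq_empty.2 (by simp), Finset.sum_empty]

lemma upsilon_succ_succ (δ : ℝ) {p n : ℕ} (hn : n < p) :
    upsilon δ (p + 1) (n + 1) =
      upsilon δ p n + ((p : ℝ) - (n + 1) * δ) * upsilon δ p (n + 1) := by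
  obtain ⟨m, rfl⟩ : ∃ m, p = n + m + 1 := ⟨p - n - 1, by omega⟩
  have hIcc : Finset.Icc 1 (n + m + 1) = insert (n + m + 1) (Finset.Icc 1 (n + m)) :=
    (Finset.insert_Icc_right_eq_Icc_add_one (by omega)).symm
  have hnot : n + m + 1 ∉ Finset.Icc 1 (n + m) := by simp
  have hlt : ∀ S ∈ Finset.powersetCard m (Finset.Icc 1 (n + m)), ∀ b ∈ S, b < n + m + 1 := by
    intro S hS b hb
    have := Finset.mem_Icc.1 ((Finset.mem_powersetCard.1 hS).1 hb)
    omega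
  unfold upsilon
  rw [show n + m + 1 + 1 - (n + 1) = m + 1 by omega, show n + m + 1 - n = m + 1 by omega,
    show n + m + 1 - (n + 1) = m by omega, show n + m + 1 + 1 - 1 = n + m + 1 by omega,
    show n + m + 1 - 1 = n + m by omega, hIcc, Finset.powersetCard_succ_insert hnot,
    Finset.sum_union, Finset.sum_image, Finset.mul_sum]
  · congr 1
    refine Finset.sum_congr rfl fun S hS => ?_
    have hlen : (S.sort (· ≤ ·)).length = m := by
      rw [Finset.length_sort, (Finset.mem_powersetCard.1 hS).2]
    rw [sort_insert_of_forall_lt (hlt S hS), Finset.prod_range_succ, mul_comm]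
    congr 1
    · rw [List.getD_append_right _ _ _ _ hlen.le, hlen]
      simp
      ring
    · refine Finset.prod_congr rfl fun i hi => ?_
      rw [List.getD_append _ _ _ _ (by rw [hlen]; exact Finset.mem_range.1 hi)]
  · intro S hS T hT hST
    have hmem : ∀ U ∈ Finset.powersetCard m (Finset.Icc 1 (n + m)), n + m + 1 ∉ U :=
      fun U hU h => lt_irrefl _ (hlt U hU _ h)
    rw [← Finset.erase_insert (hmem S hS), ← Finset.erase_insert (hmem T hT)]
    exact congrArg (fun U => Finset.erase U (n + m + 1)) hST
  · rw [Finset.disjoint_left]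
    intro S hS hS'
    obtain ⟨T, -, rfl⟩ := Finset.mem_image.1 hS'
    exact hnot ((Finset.mem_powersetCard.1 hS).1 (Finset.mem_insert_self _ _))

lemma sum_pow_mul_upsilon_succ (δ x : ℝ) (p : ℕ) :
    ∑ n ∈ Finset.range (p + 2), x ^ n * upsilon δ (p + 1) n =
      ∑ n ∈ Finset.range (p + 1), (x + p - n * δ) * (x ^ n * upsilon δ p n) := by
  have hzero : (p : ℝ) * upsilon δ p 0 = 0 := by
    cases p with
    | zero => simp
    | succ k => rw [upsilon_succ_zero, mul_zero]
  have hterm : ∀ n ∈ Finset.range p, x ^ (n + 1) * upsilon δ (p + 1) (n + 1) =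
      x * (x ^ n * upsilon δ p n) +
        ((p : ℝ) - (n + 1 : ℕ) * δ) * (x ^ (n + 1) * upsilon δ p (n + 1)) := by
    intro n hn
    rw [upsilon_succ_succ δ (Finset.mem_range.1 hn)]
    push_cast
    ring
  have hsplit : ∑ n ∈ Finset.range (p + 1), (x + p - n * δ) * (x ^ n * upsilon δ p n) =
      ∑ n ∈ Finset.range (p + 1), x * (x ^ n * upsilon δ p n) +
        ∑ n ∈ Finset.range (p + 1), ((p : ℝ) - n * δ) * (x ^ n * upsilon δ p n) := by
    rw [← Finset.sum_add_distrib]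
    exact Finset.sum_congr rfl fun n _ => by ring
  rw [hsplit, Finset.sum_range_succ', upsilon_succ_zero, Finset.sum_range_succ,
    Finset.sum_congr rfl hterm, Finset.sum_add_distrib, Finset.sum_range_succ _ p,
    Finset.sum_range_succ' _ p, upsilon_self, upsilon_self]
  simp only [Nat.cast_zero, zero_mul, sub_zero, pow_zero, one_mul, hzero]
  ring

/-- The closed form of the iterated derivatives, with the vanishing term `n = 0` included for
`p ≥ 1` so that it also covers `p = 0`. -/
lemma iteratedDerivWithin_exp_neg_mul_rpow (δ a : ℝ) (p : ℕ) {s : ℝ} (hs : 0 < s) :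
    iteratedDerivWithin p (fun t : ℝ => Real.exp (-(a * t ^ δ))) (Set.Ioi 0) s
      = Real.exp (-(a * s ^ δ)) * (-s) ^ (-(p : ℤ)) *
          ∑ n ∈ Finset.range (p + 1), (δ * a * s ^ δ) ^ n * upsilon δ p n := by
  induction p generalizing s with
  | zero => simp [upsilon_self]
  | succ p ih =>
    have hs0 : s ≠ 0 := hs.ne'
    have hrpow : HasDerivAt (fun t : ℝ => t ^ δ) (δ * s ^ δ / s) s := by
      refine (Real.hasDerivAt_rpow_const (p := δ) (Or.inl hs0)).congr_deriv ?_
      rw [Real.rpow_sub_one hs0]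
      ring
    have hexp : HasDerivAt (fun t : ℝ => Real.exp (-(a * t ^ δ)))
        (Real.exp (-(a * s ^ δ)) * (-(a * (δ * s ^ δ / s)))) s :=
      (hrpow.const_mul a).neg.exp
    have hzpow : HasDerivAt (fun t : ℝ => (-t) ^ (-(p : ℤ)))
        (p * (-s) ^ (-((p + 1 : ℕ) : ℤ))) s := by
      refine ((hasDerivAt_zpow (-(p : ℤ)) (-s) (Or.inl (neg_ne_zero.2 hs0))).comp s
        (hasDerivAt_neg s)).congr_deriv ?_
      push_cast
      rw [neg_add']
      ring
    have hsum : HasDerivAt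
        (fun t : ℝ => ∑ n ∈ Finset.range (p + 1), (δ * a * t ^ δ) ^ n * upsilon δ p n)
        (∑ n ∈ Finset.range (p + 1), n * δ / s * ((δ * a * s ^ δ) ^ n * upsilon δ p n)) s := by
      refine HasDerivAt.fun_sum fun n _ => ?_
      refine (((hrpow.const_mul (δ * a)).fun_pow n).mul_const (upsilon δ p n)).congr_deriv ?_
      cases n with
      | zero => simp
      | succ k =>
        rw [Nat.add_sub_cancel]
        ring
    have hderiv := (((hexp.mul hzpow).mul hsum).hasDerivWithinAt (s := Set.Ioi 0)).congr
      (f₁ := iteratedDerivWithin p (fun t : ℝ => Real.exp (-(a * t ^ δ))) (Set.Ioi 0))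
      (fun t ht => ih ht) (ih hs)
    rw [iteratedDerivWithin_succ, hderiv.derivWithin (isOpen_Ioi.uniqueDiffWithinAt hs),
      sum_pow_mul_upsilon_succ]
    have hpow : (-s) ^ (-(p : ℤ)) = -s * (-s) ^ (-((p + 1 : ℕ) : ℤ)) := by
      rw [← zpow_one_add₀ (neg_ne_zero.2 hs0)]
      congr 1
      push_cast
      ring
    have hcomb : ∑ n ∈ Finset.range (p + 1),
          (δ * a * s ^ δ + p - n * δ) * ((δ * a * s ^ δ) ^ n * upsilon δ p n) =
        (δ * a * s ^ δ + p) *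
            ∑ n ∈ Finset.range (p + 1), (δ * a * s ^ δ) ^ n * upsilon δ p n -
          s * ∑ n ∈ Finset.range (p + 1),
            n * δ / s * ((δ * a * s ^ δ) ^ n * upsilon δ p n) := by
      rw [Finset.mul_sum, Finset.mul_sum, ← Finset.sum_sub_distrib]
      refine Finset.sum_congr rfl fun n _ => ?_
      field_simp
    simp only [Pi.mul_apply, hcomb, hpow]
    generalize (-s) ^ (-((p + 1 : ℕ) : ℤ)) = z
    generalize ∑ n ∈ Finset.range (p + 1), n * δ / s * ((δ * a * s ^ δ) ^ n * upsilon δ p n) = B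
    field_simp
    ring

/-- The `p`-th derivative of the stretched exponential `s ↦ e^{−a s^δ}` on `(0,∞)`
equals `e^{−a s^δ}(−s)^{−p} Σ_{n=1}^p (δ a s^δ)^n Υ_{p,n}` (used in Appendix A). -/
theorem stretched_exponential_iterated_deriv
    (δ : ℝ) (hδ : δ ∈ Set.Ioo (0 : ℝ) 1) (a : ℝ) (ha : 0 < a)
    (p : ℕ) (hp : 1 ≤ p) (s : ℝ) (hs : 0 < s) :
    iteratedDerivWithin p (fun t : ℝ => Real.exp (-(a * t ^ δ))) (Set.Ioi 0) s
      = Real.exp (-(a * s ^ δ)) * (-s) ^ (-(p : ℤ)) *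
          ∑ n ∈ Finset.Icc 1 p, (δ * a * s ^ δ) ^ n * upsilon δ p n := by
  obtain ⟨k, rfl⟩ : ∃ k, p = k + 1 := ⟨p - 1, by omega⟩
  rw [iteratedDerivWithin_exp_neg_mul_rpow δ a (k + 1) hs, Finset.sum_range_succ',
    upsilon_succ_zero, mul_zero, add_zero, Finset.range_eq_Ico, Finset.sum_Ico_add'
      (fun n => (δ * a * s ^ δ) ^ n * upsilon δ (k + 1) n)]
  rfl
end

section
/- Let δ ∈ (0,1), A > 0, B ≥ 0, and define F(β) = (1 − A(β + B)^{δ})·log₂(1 + β) for β > 0. If β° > 0 is a stationary point, i.e., F′(β°) = 0, then F″(β°) < 0. In particular, F has at most one stationary point in (0,∞), and F is quasi-concave there. -/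
open Real Set

/-- If the derivative of `f` on `(0,∞)`, once nonpositive, is negative from there on, then `f` is
quasiconcave on `(0,∞)`. -/
lemma quasiconcaveOn_Ioi_of_deriv_neg_of_nonpos {f f' : ℝ → ℝ}
    (hf : ∀ x, 0 < x → HasDerivAt f (f' x) x)
    (hsign : ∀ x y, 0 < x → x < y → f' x ≤ 0 → f' y < 0) :
    QuasiconcaveOn ℝ (Ioi 0) f := by
  intro r
  refine Set.OrdConnected.convex ⟨?_⟩
  rintro x ⟨hx, hrx⟩ y ⟨hy, hry⟩ z ⟨hxz, hzy⟩
  have hx0 : 0 < x := hx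
  have hz : 0 < z := hx0.trans_le hxz
  refine ⟨hz, ?_⟩
  rcases le_or_gt (f' z) 0 with h | h
  · refine hry.trans ?_
    refine antitoneOn_of_deriv_nonpos (convex_Ici z)
      (fun w hw => (hf w (hz.trans_le hw)).continuousAt.continuousWithinAt)
      (fun w hw => ?_) (fun w hw => ?_) (mem_Ici.2 le_rfl) (mem_Ici.2 hzy) hzy
    · rw [interior_Ici] at hw
      exact (hf w (hz.trans hw)).differentiableAt.differentiableWithinAt
    · rw [interior_Ici] at hw
      rw [(hf w (hz.trans hw)).deriv]
      exact (hsign z w hz hw h).le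
  · refine hrx.trans ?_
    refine monotoneOn_of_deriv_nonneg (convex_Icc x z)
      (fun w hw => (hf w (hx0.trans_le hw.1)).continuousAt.continuousWithinAt)
      (fun w hw => ?_) (fun w hw => ?_) (left_mem_Icc.2 hxz) (right_mem_Icc.2 hxz) hxz
    · rw [interior_Icc] at hw
      exact (hf w (hx0.trans hw.1)).differentiableAt.differentiableWithinAt
    · rw [interior_Icc] at hw
      rw [(hf w (hx0.trans hw.1)).deriv]
      by_contra! hneg
      exact absurd (hsign w z (hx0.trans hw.1) hw.2 hneg.le) h.not_gt

/-- The function `x ↦ (x + B) / ((1 + x) log (1 + x))` is antitone on `(0,∞)` for `B ≥ 0`. -/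
lemma add_div_one_add_mul_log_anti {B x y : ℝ} (hB : 0 ≤ B) (hx : 0 < x) (hxy : x < y) :
    (y + B) / ((1 + y) * log (1 + y)) ≤ (x + B) / ((1 + x) * log (1 + x)) := by
  have hy : 0 < y := hx.trans hxy
  have hLx : 0 < log (1 + x) := log_pos (by linarith)
  have hLy : 0 < log (1 + y) := log_pos (by linarith)
  have hL : log (1 + x) ≤ log (1 + y) := log_le_log (by linarith) (by linarith)
  have hsec := Real.convexOn_mul_log.secant_mono (a := 1) (x := 1 + x) (y := 1 + y)
    (by simp) (mem_Ici.2 (by linarith)) (mem_Ici.2 (by linarith)) (by linarith) (by linarith)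
    (by linarith)
  simp only [log_one, mul_zero, sub_zero, add_sub_cancel_left] at hsec
  rw [div_le_div_iff₀ hx hy] at hsec
  have hmul : (1 + x) * log (1 + x) ≤ (1 + y) * log (1 + y) :=
    mul_le_mul (by linarith) hL hLx.le (by linarith)
  rw [div_le_div_iff₀ (by positivity) (by positivity)]
  nlinarith [mul_le_mul_of_nonneg_left hmul hB]

/-- The derivative of `x ↦ (1 - A (x + B) ^ δ) log₂ (1 + x)`. -/
lemma hasDerivAt_one_sub_rpow_mul_logb {δ A B x : ℝ} (hB : 0 ≤ B) (hx : 0 < x) :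
    HasDerivAt (fun x => (1 - A * (x + B) ^ δ) * logb 2 (1 + x))
      (((1 - A * (x + B) ^ δ) / (1 + x) - A * (δ * (x + B) ^ (δ - 1)) * log (1 + x)) / log 2)
      x := by
  have h1 : HasDerivAt (fun x : ℝ => (x + B) ^ δ) (1 * δ * (x + B) ^ (δ - 1)) x :=
    ((hasDerivAt_id x).add_const B).rpow_const (Or.inl (by simp; linarith))
  have h2 : HasDerivAt (fun x : ℝ => log (1 + x)) (1 / (1 + x)) x :=
    ((hasDerivAt_id x).const_add 1).log (by simp; linarith)
  have h3 := ((h1.const_mul A).const_sub 1).mul (h2.div_const (log 2))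
  refine h3.congr_deriv ?_
  ring

/-- The derivative of the derivative of `x ↦ (1 - A (x + B) ^ δ) log₂ (1 + x)`. -/
lemma hasDerivAt_deriv_one_sub_rpow_mul_logb {δ A B x : ℝ} (hB : 0 ≤ B) (hx : 0 < x) :
    HasDerivAt (fun x => ((1 - A * (x + B) ^ δ) / (1 + x)
        - A * (δ * (x + B) ^ (δ - 1)) * log (1 + x)) / log 2)
      ((-(1 - A * (x + B) ^ δ) / (1 + x) ^ 2 - 2 * (A * (δ * (x + B) ^ (δ - 1))) / (1 + x)
        + A * (δ * ((1 - δ) * (x + B) ^ (δ - 2))) * log (1 + x)) / log 2) x := by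
  have hp (e : ℝ) : HasDerivAt (fun x : ℝ => (x + B) ^ e) (1 * e * (x + B) ^ (e - 1)) x :=
    ((hasDerivAt_id x).add_const B).rpow_const (Or.inl (by simp; linarith))
  have h2 : HasDerivAt (fun x : ℝ => log (1 + x)) (1 / (1 + x)) x :=
    ((hasDerivAt_id x).const_add 1).log (by simp; linarith)
  have h3 := (((hp δ).const_mul A).const_sub 1).div ((hasDerivAt_id x).const_add 1)
    (by simp; linarith)
  have h4 := (((hp (δ - 1)).const_mul δ).const_mul A).mul h2
  refine ((h3.sub h4).div_const (log 2)).congr_deriv ?_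
  have hx1 : 1 + x ≠ 0 := by linarith
  have hl : log 2 ≠ 0 := (log_pos one_lt_two).ne'
  rw [show δ - 1 - 1 = δ - 2 by ring]
  simp only [id]
  field_simp
  ring

/-- Proposition 3 (second-derivative claim): for `F(β) = (1 − A(β+B)^δ)·log₂(1+β)` with
`δ ∈ (0,1)`, `A > 0`, `B ≥ 0`, any stationary point `β° > 0` satisfies `F″(β°) < 0`;
hence `F` has at most one stationary point in `(0,∞)` and is quasi-concave there. -/
theorem secrecy_throughput_stationary_point
    (δ A B : ℝ) (hδ : δ ∈ Set.Ioo (0 : ℝ) 1) (hA : 0 < A) (hB : 0 ≤ B)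
    (F : ℝ → ℝ) (hF : ∀ β, F β = (1 - A * (β + B) ^ δ) * Real.logb 2 (1 + β)) :
    (∀ β > (0 : ℝ), deriv F β = 0 → deriv (deriv F) β < 0)
      ∧ (∀ β₁ ∈ Set.Ioi (0 : ℝ), ∀ β₂ ∈ Set.Ioi (0 : ℝ),
          deriv F β₁ = 0 → deriv F β₂ = 0 → β₁ = β₂)
      ∧ QuasiconcaveOn ℝ (Set.Ioi 0) F := by
  obtain ⟨hδ0, hδ1⟩ := hδ
  obtain rfl : F = fun β => (1 - A * (β + B) ^ δ) * logb 2 (1 + β) := funext hF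
  clear hF
  set F : ℝ → ℝ := fun β => (1 - A * (β + B) ^ δ) * logb 2 (1 + β)
  set D : ℝ → ℝ := fun x => ((1 - A * (x + B) ^ δ) / (1 + x)
        - A * (δ * (x + B) ^ (δ - 1)) * log (1 + x)) / log 2 with hD
  have hFD : ∀ x, 0 < x → HasDerivAt F (D x) x := fun x hx =>
    hasDerivAt_one_sub_rpow_mul_logb hB hx
  have hl : 0 < log 2 := log_pos one_lt_two
  have hfactor : ∀ x, 0 < x → D x = (x + B) ^ δ * log (1 + x) / ((x + B) * log 2) *
      (((x + B) ^ (-δ) - A) * ((x + B) / ((1 + x) * log (1 + x))) - A * δ) := by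
    intro x hx
    have hs : 0 < x + B := by linarith
    have hL : 0 < log (1 + x) := log_pos (by linarith)
    have hp : 0 < (x + B) ^ δ := rpow_pos_of_pos hs δ
    have hx1 : 1 + x ≠ 0 := by linarith
    simp only [hD]
    rw [rpow_sub_one hs.ne', rpow_neg hs.le]
    field_simp
  have hsign : ∀ x y, 0 < x → x < y → D x ≤ 0 → D y < 0 := by
    intro x y hx hxy h
    have hy : 0 < y := hx.trans hxy
    have hpre : ∀ z, 0 < z → 0 < (z + B) ^ δ * log (1 + z) / ((z + B) * log 2) := by
      intro z hz
      have hs : 0 < z + B := by linarith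
      have hL : 0 < log (1 + z) := log_pos (by linarith)
      positivity
    rw [hfactor x hx] at h
    rw [hfactor y hy]
    refine mul_neg_of_pos_of_neg (hpre y hy) ?_
    have h' := nonpos_of_mul_nonpos_right h (hpre x hx)
    have hw : (y + B) ^ (-δ) < (x + B) ^ (-δ) :=
      rpow_lt_rpow_of_neg (by linarith) (by linarith) (by linarith)
    have hq := add_div_one_add_mul_log_anti hB hx hxy
    have hLy : 0 < log (1 + y) := log_pos (by linarith)
    have hqy : 0 < (y + B) / ((1 + y) * log (1 + y)) := by positivity
    have hAδ : 0 < A * δ := by positivity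
    rcases le_or_gt ((y + B) ^ (-δ) - A) 0 with hneg | hpos
    · nlinarith [mul_nonneg (neg_nonneg.2 hneg) hqy.le]
    · have := mul_lt_mul (sub_lt_sub_right hw A) hq hqy (by linarith)
      linarith
  refine ⟨fun x hx h => ?_, fun x hx y hy h₁ h₂ => ?_,
    quasiconcaveOn_Ioi_of_deriv_neg_of_nonpos hFD hsign⟩
  · have heq : deriv F =ᶠ[nhds x] D := by
      filter_upwards [Ioi_mem_nhds hx] with z hz using (hFD z hz).deriv
    rw [heq.deriv_eq, (hasDerivAt_deriv_one_sub_rpow_mul_logb hB hx).deriv]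
    rw [(hFD x hx).deriv] at h
    have hs : 0 < x + B := by linarith
    have hx1 : 0 < 1 + x := by linarith
    have hL : 0 < log (1 + x) := log_pos (by linarith)
    have hLx : log (1 + x) ≤ x := by linarith [log_le_sub_one_of_pos hx1]
    have hstat : (1 - A * (x + B) ^ δ) / (1 + x) =
        A * (δ * (x + B) ^ (δ - 1)) * log (1 + x) :=
      sub_eq_zero.1 ((div_eq_zero_iff.1 h).resolve_right hl.ne')
    have hpow : (x + B) ^ (δ - 1) = (x + B) ^ (δ - 2) * (x + B) := by
      rw [← rpow_add_one hs.ne']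
      ring_nf
    have hkey : (-(1 - A * (x + B) ^ δ) / (1 + x) ^ 2
        - 2 * (A * (δ * (x + B) ^ (δ - 1))) / (1 + x)
        + A * (δ * ((1 - δ) * (x + B) ^ (δ - 2))) * log (1 + x)) =
        A * δ * (x + B) ^ (δ - 2) / (1 + x) *
          ((1 - δ) * (log (1 + x) * (1 + x)) - (x + B) * log (1 + x) - 2 * (x + B)) := by
      have : -(1 - A * (x + B) ^ δ) / (1 + x) ^ 2 =
          -((1 - A * (x + B) ^ δ) / (1 + x)) / (1 + x) := by
        field_simp
      rw [this, hstat, hpow]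
      field_simp
      ring
    rw [hkey]
    refine div_neg_of_neg_of_pos (mul_neg_of_pos_of_neg (by positivity) ?_) hl
    nlinarith [mul_pos hδ0 (mul_pos hL hx1), mul_nonneg hB hL.le]
  · rw [(hFD x hx).deriv] at h₁
    rw [(hFD y hy).deriv] at h₂
    rcases lt_trichotomy x y with hlt | heq | hgt
    · exact absurd h₂ (hsign x y hx hlt h₁.le).ne
    · exact heq
    · exact absurd h₁ (hsign y x hy hgt h₂.le).ne
end

section
/- Let α > 2, K ≥ 1 an integer, and X_1,…,X_K, Y, Z > 0. For ρ > 0 define W_k(ρ) = 1 + X_k(1+Yρ)^{−α/2}, Q(ρ) = 1 + Zρ^{−α/2}, T(ρ) = Σ_{k=1}^{K} ln(W_k(ρ)/Q(ρ)), κ(ρ) = (1/K)Σ_{k=1}^{K} 1/W_k(ρ), and G(ρ) = 1 + Yρ·κ(ρ) − (Y/Z)·ρ^{α/2+1}·(1 − κ(ρ)). Then T is differentiable on (0,∞) and for every ρ > 0, T′(ρ) = (αK(Q(ρ)−1)/(2ρ·Q(ρ)·(1+Yρ)))·G(ρ); in particular, since the prefactor is positive, T′(ρ) and G(ρ) have the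 same sign. -/
open Real Set Finset

/-- The logarithmic derivative of `1 + c * u ^ (-p)` for positive `c` and `u`. -/
theorem hasDerivAt_log_one_add_mul_rpow_neg {u : ℝ → ℝ} {u' x c : ℝ} (p : ℝ) (hc : 0 < c)
    (hu : HasDerivAt u u' x) (hx : 0 < u x) :
    HasDerivAt (fun y => Real.log (1 + c * u y ^ (-p)))
      (-(p * u' / u x * (1 - 1 / (1 + c * u x ^ (-p))))) x := by
  have hpos : 0 < u x ^ (-p) := Real.rpow_pos_of_pos hx _
  have hne : 1 + c * u x ^ (-p) ≠ 0 := by positivity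
  convert (((hu.rpow_const (p := -p) (Or.inl hx.ne')).const_mul c).const_add 1).log hne using 1
  rw [Real.rpow_sub_one hx.ne']
  field_simp
  ring

/-- Derivative reconstruction identity (27) in the proof of Proposition 5: with
`W_k(ρ) = 1 + X_k(1+Yρ)^{−α/2}`, `Q(ρ) = 1 + Zρ^{−α/2}`,
`T(ρ) = Σ_k ln(W_k(ρ)/Q(ρ))`, `κ(ρ) = (1/K)Σ_k 1/W_k(ρ)`, and
`G(ρ) = 1 + Yρκ(ρ) − (Y/Z)ρ^{α/2+1}(1−κ(ρ))`, the function `T` is differentiable on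
`(0,∞)` with `T′(ρ) = (αK(Q(ρ)−1)/(2ρ Q(ρ)(1+Yρ)))·G(ρ)` for every `ρ > 0`. -/
theorem sum_secrecy_throughput_derivative
    (α : ℝ) (hα : 2 < α) (K : ℕ) (hK : 1 ≤ K)
    (X : Fin K → ℝ) (Y Z : ℝ) (hX : ∀ k, 0 < X k) (hY : 0 < Y) (hZ : 0 < Z)
    (W : Fin K → ℝ → ℝ) (hW : ∀ k ρ, W k ρ = 1 + X k * (1 + Y * ρ) ^ (-(α / 2)))
    (Q : ℝ → ℝ) (hQ : ∀ ρ, Q ρ = 1 + Z * ρ ^ (-(α / 2)))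
    (T : ℝ → ℝ) (hT : ∀ ρ, T ρ = ∑ k, Real.log (W k ρ / Q ρ))
    (κ : ℝ → ℝ) (hκ : ∀ ρ, κ ρ = ((K : ℝ))⁻¹ * ∑ k, 1 / W k ρ)
    (G : ℝ → ℝ)
    (hG : ∀ ρ, G ρ = 1 + Y * ρ * κ ρ - (Y / Z) * ρ ^ (α / 2 + 1) * (1 - κ ρ)) :
    ∀ ρ > (0 : ℝ),
      HasDerivAt T ((α * K * (Q ρ - 1) / (2 * ρ * Q ρ * (1 + Y * ρ))) * G ρ) ρ := by
  intro ρ hρ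
  have hu : 0 < 1 + Y * ρ := by positivity
  have hW_pos : ∀ k, ∀ y > (0 : ℝ), 0 < W k y := fun k y hy => by
    rw [hW]
    have := hX k
    positivity
  have hQ_pos : ∀ y > (0 : ℝ), 0 < Q y := fun y hy => by
    rw [hQ]
    positivity
  have hT_eq : T =ᶠ[nhds ρ] fun y => ∑ k, (Real.log (W k y) - Real.log (Q y)) := by
    filter_upwards [eventually_gt_nhds hρ] with y hy
    rw [hT]
    exact Finset.sum_congr rfl fun k _ => Real.log_div (hW_pos k y hy).ne' (hQ_pos y hy).ne'
  have hlogW : ∀ k, HasDerivAt (fun y => Real.log (W k y))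
      (-(α / 2 * Y / (1 + Y * ρ) * (1 - 1 / W k ρ))) ρ := fun k => by
    have hlin : HasDerivAt (fun y => 1 + Y * y) Y ρ := by
      simpa using ((hasDerivAt_id ρ).const_mul Y).const_add 1
    simpa only [hW] using hasDerivAt_log_one_add_mul_rpow_neg (α / 2) (hX k) hlin hu
  have hlogQ : HasDerivAt (fun y => Real.log (Q y)) (-(α / 2 * 1 / ρ * (1 - 1 / Q ρ))) ρ := by
    simpa only [hQ] using hasDerivAt_log_one_add_mul_rpow_neg (α / 2) hZ (hasDerivAt_id' ρ) hρ
  have hK_ne : (K : ℝ) ≠ 0 := by exact_mod_cast (show K ≠ 0 by omega)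
  have hsum : ∑ k, 1 / W k ρ = K * κ ρ := by
    rw [hκ, mul_inv_cancel_left₀ hK_ne]
  have hpow : (Q ρ - 1) * ρ ^ (α / 2 + 1) = Z * ρ := by
    rw [hQ, add_sub_cancel_left, mul_assoc, ← Real.rpow_add hρ,
      show -(α / 2) + (α / 2 + 1) = 1 by ring, Real.rpow_one]
  refine (HasDerivAt.congr_of_eventuallyEq
    (HasDerivAt.fun_sum fun k _ => (hlogW k).sub hlogQ) hT_eq).congr_deriv ?_
  have hQ_ne : Q ρ ≠ 0 := (hQ_pos ρ hρ).ne'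
  rw [Finset.sum_sub_distrib, Finset.sum_neg_distrib, ← Finset.mul_sum, Finset.sum_sub_distrib,
    hsum, hG]
  simp only [Finset.sum_const, Finset.card_univ, Fintype.card_fin, nsmul_eq_mul, mul_one]
  have hG_mul : (Q ρ - 1) * (1 + Y * ρ * κ ρ - Y / Z * ρ ^ (α / 2 + 1) * (1 - κ ρ)) =
      (Q ρ - 1) * (1 + Y * ρ * κ ρ) - Y * ρ * (1 - κ ρ) := by
    have : Y / Z * (Z * ρ) = Y * ρ := by field_simp
    linear_combination (-(Y / Z) * (1 - κ ρ)) * hpow - (1 - κ ρ) * this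
  rw [div_mul_eq_mul_div (α * K * _), mul_assoc (α * K), hG_mul]
  field_simp
  ring
end

section
/- Let α > 2, δ = 2/α, K ≥ 1 an integer, and X_1,…,X_K, Y, Z > 0 with (X_k/Z)^{δ} > Y for every k. Set ρ_min = max_{1≤k≤K} ((X_k/Z)^{δ} − Y)^{−1}, and define κ(ρ) = (1/K)Σ_{k=1}^{K} 1/(1 + X_k(1+Yρ)^{−α/2}) and G(ρ) = 1 + Yρ·κ(ρ) − (Y/Z)·ρ^{α/2+1}·(1 − κ(ρ)). Then G is strictly decreasing on [ρ_min, ∞). -/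
open Real Set Finset

/-- Moving a power of `ρ` across the base `1 + Y ρ = ρ (ρ⁻¹ + Y)`. -/
lemma rpow_add_one_mul_one_add_mul_rpow_neg {Y ρ : ℝ} (hY : 0 < Y) (hρ : 0 < ρ) (a : ℝ) :
    ρ ^ (a + 1) * (1 + Y * ρ) ^ (-a) = ρ * (ρ⁻¹ + Y) ^ (-a) := by
  have h : 1 + Y * ρ = ρ * (ρ⁻¹ + Y) := by field_simp
  rw [h, Real.mul_rpow hρ.le (by positivity), ← mul_assoc, ← Real.rpow_add hρ]
  simp

lemma mul_div_one_add_mul_rpow_neg_lt {a X Y x y : ℝ} (ha : 0 < a) (hX : 0 < X) (hY : 0 < Y)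
    (hx : 0 < x) (hxy : x < y) :
    Y * x / (1 + X * (1 + Y * x) ^ (-a)) < Y * y / (1 + X * (1 + Y * y) ^ (-a)) := by
  have hy := hx.trans hxy
  have hpow : (1 + Y * y) ^ (-a) ≤ (1 + Y * x) ^ (-a) :=
    Real.rpow_le_rpow_of_nonpos (by positivity) (by gcongr) (by linarith)
  calc Y * x / (1 + X * (1 + Y * x) ^ (-a)) ≤ Y * x / (1 + X * (1 + Y * y) ^ (-a)) := by
        gcongr
    _ < Y * y / (1 + X * (1 + Y * y) ^ (-a)) := by gcongr

lemma mul_inv_add_rpow_neg_sub_one_lt {a c Y x y : ℝ} (ha : 0 < a) (hc : 0 < c) (hY : 0 < Y)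
    (hx : 0 < x) (hxy : x < y) :
    c * (x⁻¹ + Y) ^ (-a) - 1 < c * (y⁻¹ + Y) ^ (-a) - 1 := by
  have hy := hx.trans hxy
  have hpow : (x⁻¹ + Y) ^ (-a) < (y⁻¹ + Y) ^ (-a) :=
    Real.rpow_lt_rpow_of_neg (by positivity) (by gcongr) (by linarith)
  gcongr

lemma mul_inv_add_rpow_neg_sub_one_nonneg {a c Y x : ℝ} (ha : 0 < a) (hc : 0 < c) (hY : 0 < Y)
    (hcY : Y < c ^ a⁻¹) (hx : (c ^ a⁻¹ - Y)⁻¹ ≤ x) :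
    0 ≤ c * (x⁻¹ + Y) ^ (-a) - 1 := by
  have hd : 0 < c ^ a⁻¹ - Y := sub_pos.2 hcY
  have hx0 : 0 < x := (inv_pos.2 hd).trans_le hx
  have hbase : x⁻¹ + Y ≤ c ^ a⁻¹ := by
    linarith [inv_le_of_inv_le₀ hd hx]
  have hpow : (x⁻¹ + Y) ^ a ≤ c := by
    calc (x⁻¹ + Y) ^ a ≤ (c ^ a⁻¹) ^ a := by gcongr
      _ = c := Real.rpow_inv_rpow hc.le ha.ne'
  rw [Real.rpow_neg (by positivity), ← div_eq_mul_inv, sub_nonneg, one_le_div (by positivity)]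
  exact hpow

/-- Central structural claim in the proof of Proposition 5: with
`κ(ρ) = (1/K)Σ_k 1/(1 + X_k(1+Yρ)^{−α/2})` and
`G(ρ) = 1 + Yρκ(ρ) − (Y/Z)ρ^{α/2+1}(1−κ(ρ))`, and
`ρ_min = max_k ((X_k/Z)^δ − Y)^{−1}`, the function `G` is strictly decreasing on
`[ρ_min, ∞)`. -/
theorem G_strictAnti
    (α δ : ℝ) (hα : 2 < α) (hδ : δ = 2 / α) (K : ℕ) (hK : 1 ≤ K)
    (X : Fin K → ℝ) (Y Z : ℝ) (hX : ∀ k, 0 < X k) (hY : 0 < Y) (hZ : 0 < Z)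
    (hXZ : ∀ k, Y < (X k / Z) ^ δ)
    (ρmin : ℝ)
    (hρmin : IsGreatest (Set.range fun k => ((X k / Z) ^ δ - Y)⁻¹) ρmin)
    (κ : ℝ → ℝ)
    (hκ : ∀ ρ, κ ρ = ((K : ℝ))⁻¹ * ∑ k, 1 / (1 + X k * (1 + Y * ρ) ^ (-(α / 2))))
    (G : ℝ → ℝ)
    (hG : ∀ ρ, G ρ = 1 + Y * ρ * κ ρ - (Y / Z) * ρ ^ (α / 2 + 1) * (1 - κ ρ)) :
    StrictAntiOn G (Set.Ici ρmin) := by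
  have hK0 : (0 : ℝ) < K := by exact_mod_cast hK
  have ha : 0 < α / 2 := by linarith
  have hδ' : δ = (α / 2)⁻¹ := by rw [hδ, inv_div]
  have hmin0 : 0 < ρmin := by
    obtain ⟨k, rfl⟩ := hρmin.1
    exact inv_pos.2 (sub_pos.2 (hXZ k))
  have factor : ∀ ρ, 0 < ρ → G ρ = 1 - (K : ℝ)⁻¹ * ∑ k,
      Y * ρ / (1 + X k * (1 + Y * ρ) ^ (-(α / 2))) *
        (X k / Z * (ρ⁻¹ + Y) ^ (-(α / 2)) - 1) := by
    intro ρ hρ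
    have hκ' : 1 - κ ρ = (K : ℝ)⁻¹ * ∑ k, (1 - 1 / (1 + X k * (1 + Y * ρ) ^ (-(α / 2)))) := by
      rw [hκ, Finset.sum_sub_distrib, mul_sub]
      simp [hK0.ne']
    have hterm : ∀ k, Y * ρ / (1 + X k * (1 + Y * ρ) ^ (-(α / 2))) *
          (X k / Z * (ρ⁻¹ + Y) ^ (-(α / 2)) - 1) =
        Y / Z * ρ ^ (α / 2 + 1) * (1 - 1 / (1 + X k * (1 + Y * ρ) ^ (-(α / 2)))) -
          Y * ρ * (1 / (1 + X k * (1 + Y * ρ) ^ (-(α / 2)))) := by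
      intro k
      have hb := rpow_add_one_mul_one_add_mul_rpow_neg hY hρ (α / 2)
      have hXk := hX k
      have hu : 0 < (1 + Y * ρ) ^ (-(α / 2)) := by positivity
      generalize (1 + Y * ρ) ^ (-(α / 2)) = u at *
      generalize (ρ⁻¹ + Y) ^ (-(α / 2)) = v at *
      generalize ρ ^ (α / 2 + 1) = w at *
      have hW : 1 + X k * u ≠ 0 := by positivity
      field_simp
      linear_combination (-X k) * hb
    rw [Finset.sum_congr rfl fun k _ => hterm k, Finset.sum_sub_distrib,
      ← Finset.mul_sum, ← Finset.mul_sum, hG, hκ', hκ]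
    ring
  intro x hx y _ hxy
  have hx0 : 0 < x := hmin0.trans_le hx
  rw [factor x hx0, factor y (hx0.trans hxy)]
  have : Nonempty (Fin K) := ⟨⟨0, hK⟩⟩
  refine sub_lt_sub_left (mul_lt_mul_of_pos_left
    (Finset.sum_lt_sum_of_nonempty Finset.univ_nonempty fun k _ => ?_) (inv_pos.2 hK0)) 1
  have hc : 0 < X k / Z := div_pos (hX k) hZ
  have hXk := hX k
  have hy0 := hx0.trans hxy
  exact mul_lt_mul'' (mul_div_one_add_mul_rpow_neg_lt ha hXk hY hx0 hxy)
    (mul_inv_add_rpow_neg_sub_one_lt ha hc hY hx0 hxy) (by positivity)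
    (mul_inv_add_rpow_neg_sub_one_nonneg ha hc hY (hδ' ▸ hXZ k)
      (hδ' ▸ (hρmin.2 ⟨k, rfl⟩).trans hx))
end

section
/- With the setup below and assuming ρ_min < 1: the condition G(1) ≥ 0 is equivalent to Z ≥ Y·(1 − κ(1))/(1 + Y·κ(1)); and if G(1) ≥ 0 then T is strictly increasing on [ρ_min, 1], so ρ = 1 is the unique maximizer of T over [ρ_min, 1]. -/
open Real Set Finset

/-- The excess of a user with gain `x` at jamming power `ρ`; the derivative of the user's secrecy
throughput has the sign of `1 - Y * jammingExcess a Y Z x ρ`. -/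
noncomputable def jammingExcess (a Y Z x ρ : ℝ) : ℝ :=
  ρ * (1 / (1 + x * (1 + Y * ρ) ^ (-a))) * (x / Z * (ρ / (1 + Y * ρ)) ^ a - 1)

theorem jammingExcess_lt {a Y Z x ρ σ : ℝ} (ha : 0 < a) (hY : 0 < Y) (hZ : 0 < Z) (hx : 0 < x)
    (hρ : 0 < ρ) (hρσ : ρ < σ) (h : 1 ≤ x / Z * (ρ / (1 + Y * ρ)) ^ a) :
    jammingExcess a Y Z x ρ < jammingExcess a Y Z x σ := by
  have hσ : 0 < σ := hρ.trans hρσ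
  have hu : 0 < 1 + Y * ρ := by positivity
  have hv : 0 < 1 + Y * σ := by positivity
  have huv : 1 + Y * ρ < 1 + Y * σ := by gcongr
  have hratio : ρ / (1 + Y * ρ) < σ / (1 + Y * σ) := by
    rw [div_lt_div_iff₀ hu hv]
    nlinarith
  have hpow : (ρ / (1 + Y * ρ)) ^ a < (σ / (1 + Y * σ)) ^ a :=
    Real.rpow_lt_rpow (by positivity) hratio ha
  have hneg : (1 + Y * σ) ^ (-a) < (1 + Y * ρ) ^ (-a) :=
    Real.rpow_lt_rpow_of_neg hu huv (neg_lt_zero.mpr ha)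
  have hfactor : x / Z * (ρ / (1 + Y * ρ)) ^ a < x / Z * (σ / (1 + Y * σ)) ^ a := by gcongr
  have hinv : 1 / (1 + x * (1 + Y * ρ) ^ (-a)) < 1 / (1 + x * (1 + Y * σ) ^ (-a)) := by
    have := Real.rpow_pos_of_pos hv (-a)
    gcongr
  have hinv_pos : 0 < 1 / (1 + x * (1 + Y * ρ) ^ (-a)) := by positivity
  exact mul_lt_mul'' (mul_lt_mul'' hρσ hinv hρ.le hinv_pos.le) (by linarith)
    (by positivity) (by linarith)

theorem jammingExcess_eq {a Y Z x ρ : ℝ} (hY : 0 < Y) (hZ : 0 < Z) (hx : 0 < x) (hρ : 0 < ρ) :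
    jammingExcess a Y Z x ρ =
      ρ ^ (a + 1) / Z * (1 - 1 / (1 + x * (1 + Y * ρ) ^ (-a)))
        - ρ * (1 / (1 + x * (1 + Y * ρ) ^ (-a))) := by
  have hu : 0 < 1 + Y * ρ := by positivity
  have hua : 0 < (1 + Y * ρ) ^ a := Real.rpow_pos_of_pos hu a
  unfold jammingExcess
  rw [Real.div_rpow hρ.le hu.le, Real.rpow_neg hu.le, Real.rpow_add_one hρ.ne']
  generalize (1 + Y * ρ) ^ a = q at *
  field_simp
  ring

theorem hasDerivAt_secrecyThroughput {a Y Z x ρ : ℝ} (hY : 0 < Y) (hZ : 0 < Z) (hx : 0 < x)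
    (hρ : 0 < ρ) :
    HasDerivAt (fun t => Real.log ((1 + x * (1 + Y * t) ^ (-a)) / (1 + Z * t ^ (-a))))
      (a * Z / (ρ * (1 + Y * ρ) * (ρ ^ a + Z)) * (1 - Y * jammingExcess a Y Z x ρ)) ρ := by
  have hu : 0 < 1 + Y * ρ := by positivity
  have hua : 0 < (1 + Y * ρ) ^ a := Real.rpow_pos_of_pos hu a
  have hρa : 0 < ρ ^ a := Real.rpow_pos_of_pos hρ a
  have hW : 0 < 1 + x * (1 + Y * ρ) ^ (-a) := by positivity
  have hQ : 0 < 1 + Z * ρ ^ (-a) := by positivity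
  have hlin : HasDerivAt (fun t => 1 + Y * t) (Y * 1) ρ :=
    ((hasDerivAt_id ρ).const_mul Y).const_add 1
  have hdW := ((hlin.rpow_const (p := -a) (Or.inl hu.ne')).const_mul x).const_add 1
  have hdQ := (((hasDerivAt_id ρ).rpow_const (p := -a) (Or.inl hρ.ne')).const_mul Z).const_add 1
  refine ((hdW.div hdQ hQ.ne').log (div_pos hW hQ).ne').congr_deriv ?_
  simp only [id, Pi.div_apply]
  rw [jammingExcess_eq hY hZ hx hρ, Real.rpow_sub_one hu.ne', Real.rpow_sub_one hρ.ne',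
    Real.rpow_neg hu.le, Real.rpow_neg hρ.le, Real.rpow_add_one hρ.ne']
  generalize (1 + Y * ρ) ^ a = q at *
  generalize ρ ^ a = r at *
  field_simp
  ring

theorem one_le_of_inv_le {α Y Z x ρ : ℝ} (hα : 0 < α) (hY : 0 < Y) (hZ : 0 < Z) (hx : 0 < x)
    (hρ : 0 < ρ) (hxZ : Y < (x / Z) ^ (2 / α)) (h : ((x / Z) ^ (2 / α) - Y)⁻¹ ≤ ρ) :
    1 ≤ x / Z * (ρ / (1 + Y * ρ)) ^ (α / 2) := by
  have hu : 0 < 1 + Y * ρ := by positivity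
  have hroot : 1 ≤ (x / Z) ^ (2 / α) * (ρ / (1 + Y * ρ)) := by
    rw [inv_le_iff_one_le_mul₀ (sub_pos.mpr hxZ)] at h
    rw [← mul_div_assoc, one_le_div hu]
    linarith
  have hpow := Real.one_le_rpow hroot (half_pos hα).le
  rwa [Real.mul_rpow (by positivity) (by positivity), ← Real.rpow_mul (by positivity),
    show 2 / α * (α / 2) = 1 by field_simp, Real.rpow_one] at hpow

/-- Second case of Proposition 5 (equation (28), second branch): with the setup of the
sub-optimal design and `ρ_min < 1`, the condition `G(1) ≥ 0` is equivalent to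
`Z ≥ Y(1−κ(1))/(1+Yκ(1))`, and if `G(1) ≥ 0` then the sum secrecy throughput `T` is
strictly increasing on `[ρ_min, 1]`, so `ρ = 1` is the unique maximizer of `T` over
`[ρ_min, 1]`. -/
theorem optimal_jamming_second_case
    (α δ : ℝ) (hα : 2 < α) (hδ : δ = 2 / α) (K : ℕ) (hK : 1 ≤ K)
    (X : Fin K → ℝ) (Y Z : ℝ) (hX : ∀ k, 0 < X k) (hY : 0 < Y) (hZ : 0 < Z)
    (hXZ : ∀ k, Y < (X k / Z) ^ δ)
    (ρmin : ℝ)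
    (hρmin : IsGreatest (Set.range fun k => ((X k / Z) ^ δ - Y)⁻¹) ρmin)
    (hρmin1 : ρmin < 1)
    (T : ℝ → ℝ)
    (hT : ∀ ρ, T ρ = ∑ k, Real.log
        ((1 + X k * (1 + Y * ρ) ^ (-(α / 2))) / (1 + Z * ρ ^ (-(α / 2)))))
    (κ : ℝ → ℝ)
    (hκ : ∀ ρ, κ ρ = ((K : ℝ))⁻¹ * ∑ k, 1 / (1 + X k * (1 + Y * ρ) ^ (-(α / 2))))
    (G : ℝ → ℝ)
    (hG : ∀ ρ, G ρ = 1 + Y * ρ * κ ρ - (Y / Z) * ρ ^ (α / 2 + 1) * (1 - κ ρ)) :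
    (0 ≤ G 1 ↔ Y * (1 - κ 1) / (1 + Y * κ 1) ≤ Z)
      ∧ (0 ≤ G 1 →
          StrictMonoOn T (Set.Icc ρmin 1)
            ∧ ∀ ρ ∈ Set.Icc ρmin 1, ρ ≠ 1 → T ρ < T 1) := by
  have hα0 : 0 < α := by linarith
  have ha : 0 < α / 2 := by linarith
  have hK0 : (0 : ℝ) < K := by exact_mod_cast hK
  have : Nonempty (Fin K) := ⟨⟨0, hK⟩⟩
  subst hδ
  have hρmin0 : 0 < ρmin := by
    obtain ⟨k, rfl⟩ := hρmin.1
    exact inv_pos.mpr (sub_pos.mpr (hXZ k))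
  have hGsum (ρ : ℝ) (hρ : 0 < ρ) :
      ∑ k, (1 - Y * jammingExcess (α / 2) Y Z (X k) ρ) = K * G ρ := by
    simp only [jammingExcess_eq hY hZ (hX _) hρ, hG, hκ, Finset.sum_sub_distrib,
      ← Finset.mul_sum, Finset.sum_const, Finset.card_univ, Fintype.card_fin, nsmul_eq_mul]
    generalize ∑ k, 1 / (1 + X k * (1 + Y * ρ) ^ (-(α / 2))) = S
    field_simp
    ring
  constructor
  · have hκ1 : 0 ≤ κ 1 := by
      rw [hκ]
      have (k : Fin K) : 0 ≤ 1 / (1 + X k * (1 + Y * 1) ^ (-(α / 2))) := by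
        have := hX k
        positivity
      exact mul_nonneg (by positivity) (Finset.sum_nonneg fun k _ => this k)
    rw [hG, Real.one_rpow, div_le_iff₀ (by positivity), sub_nonneg, mul_one, mul_one,
      div_mul_eq_mul_div, div_le_iff₀ hZ, mul_comm Z]
  · intro hG1
    have hmono : StrictMonoOn T (Set.Icc ρmin 1) := by
      have hderiv (ρ : ℝ) (hρ : 0 < ρ) : HasDerivAt T
          (α / 2 * Z / (ρ * (1 + Y * ρ) * (ρ ^ (α / 2) + Z)) * (K * G ρ)) ρ := by
        rw [← hGsum ρ hρ, Finset.mul_sum, funext hT]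
        exact HasDerivAt.fun_sum fun k _ => hasDerivAt_secrecyThroughput hY hZ (hX k) hρ
      refine strictMonoOn_of_deriv_pos (convex_Icc _ _) (fun ρ hρ =>
        (hderiv ρ (hρmin0.trans_le hρ.1)).continuousAt.continuousWithinAt) fun ρ hρ => ?_
      rw [interior_Icc] at hρ
      have hρ0 : 0 < ρ := hρmin0.trans hρ.1
      have hlt : K * G 1 < K * G ρ := by
        rw [← hGsum 1 one_pos, ← hGsum ρ hρ0]
        refine Finset.sum_lt_sum_of_nonempty Finset.univ_nonempty fun k _ => ?_
        have := jammingExcess_lt ha hY hZ (hX k) hρ0 hρ.2 (one_le_of_inv_le hα0 hY hZ (hX k) hρ0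
          (hXZ k) ((hρmin.2 (Set.mem_range_self k)).trans hρ.1.le))
        gcongr
      have hKG : 0 < K * G ρ := (mul_nonneg hK0.le hG1).trans_lt hlt
      rw [(hderiv ρ hρ0).deriv]
      positivity
    exact ⟨hmono, fun ρ hρ hne =>
      hmono hρ ⟨hρmin1.le, le_rfl⟩ (lt_of_le_of_ne hρ.2 hne)⟩
end

section
/- With the setup below, assume ρ_min < 1, G(ρ_min) ≥ 0, and G(1) < 0. Then there exists a unique ρ° ∈ [ρ_min, 1) with G(ρ°) = 0; moreover T is monotonically increasing on [ρ_min, ρ°] and strictly decreasing on [ρ°, 1], so ρ° is the unique maximizer of T over [ρ_min, 1]. -/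
open Real Set Finset

/-- The contribution of a single index to the function whose sign is that of the derivative of the
sum of log-ratios. -/
noncomputable def signTerm (a x Y Z ρ : ℝ) : ℝ :=
  1 + Y * ρ * (1 / (1 + x * (1 + Y * ρ) ^ (-a)))
    - (Y / Z) * ρ ^ (a + 1) * (1 - 1 / (1 + x * (1 + Y * ρ) ^ (-a)))

lemma one_add_mul_rpow_pos {a x Y ρ : ℝ} (hx : 0 < x) (hY : 0 < Y) (hρ : 0 < ρ) :
    0 < 1 + x * (1 + Y * ρ) ^ (-a) := by
  have : 0 < (1 + Y * ρ) ^ (-a) := rpow_pos_of_pos (by positivity) _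
  positivity

lemma hasDerivAt_log_ratio {a x Y Z ρ : ℝ} (hx : 0 < x) (hY : 0 < Y) (hZ : 0 < Z) (hρ : 0 < ρ) :
    HasDerivAt (fun r => Real.log ((1 + x * (1 + Y * r) ^ (-a)) / (1 + Z * r ^ (-a))))
      (a * Z * ρ ^ (-a - 1) / ((1 + Y * ρ) * (1 + Z * ρ ^ (-a))) * signTerm a x Y Z ρ) ρ := by
  have hv : 0 < 1 + Y * ρ := by positivity
  have hW : 0 < 1 + x * (1 + Y * ρ) ^ (-a) := one_add_mul_rpow_pos hx hY hρ
  have hr : 0 < ρ ^ (-a) := rpow_pos_of_pos hρ _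
  have hQ : 0 < 1 + Z * ρ ^ (-a) := by positivity
  have d1 : HasDerivAt (fun r : ℝ => 1 + x * (1 + Y * r) ^ (-a))
      (x * (Y * (-a) * (1 + Y * ρ) ^ (-a - 1))) ρ := by
    have : HasDerivAt (fun r : ℝ => 1 + Y * r) Y ρ := by
      simpa using ((hasDerivAt_id ρ).const_mul Y).const_add 1
    exact ((this.rpow_const (Or.inl hv.ne')).const_mul x).const_add 1
  have d2 : HasDerivAt (fun r : ℝ => 1 + Z * r ^ (-a)) (Z * (-a * ρ ^ (-a - 1))) ρ :=
    ((hasDerivAt_rpow_const (Or.inl hρ.ne')).const_mul Z).const_add 1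
  refine ((d1.div d2 hQ.ne').log (div_pos hW hQ).ne').congr_deriv ?_
  rw [signTerm]
  have e1 : (1 + Y * ρ) ^ (-a - 1) = (1 + Y * ρ) ^ (-a) / (1 + Y * ρ) := by
    rw [rpow_sub hv, rpow_one]
  have e2 : ρ ^ (-a - 1) = ρ ^ (-a) / ρ := by rw [rpow_sub hρ, rpow_one]
  have e3 : ρ ^ (a + 1) = ρ / ρ ^ (-a) := by
    rw [rpow_add hρ, rpow_one, rpow_neg hρ.le]; field_simp
  simp only [Pi.div_apply, e1, e2, e3]
  generalize (1 + Y * ρ) ^ (-a) = p at *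
  generalize ρ ^ (-a) = q at *
  field_simp
  ring

lemma continuousOn_signTerm {a x Y Z : ℝ} (hx : 0 < x) (hY : 0 < Y) :
    ContinuousOn (signTerm a x Y Z) (Set.Ioi 0) := by
  intro ρ hρ
  have hρ : 0 < ρ := hρ
  have hv : 1 + Y * ρ ≠ 0 := by positivity
  have hW : 1 + x * (1 + Y * ρ) ^ (-a) ≠ 0 := (one_add_mul_rpow_pos hx hY hρ).ne'
  have h1 : ContinuousAt (fun r : ℝ => (1 + Y * r) ^ (-a)) ρ :=
    ContinuousAt.rpow_const (by fun_prop) (Or.inl hv)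
  have h2 : ContinuousAt (fun r : ℝ => r ^ (a + 1)) ρ :=
    ContinuousAt.rpow_const (by fun_prop) (Or.inl hρ.ne')
  have h3 : ContinuousAt (fun r : ℝ => 1 / (1 + x * (1 + Y * r) ^ (-a))) ρ :=
    continuousAt_const.div (continuousAt_const.add (continuousAt_const.mul h1)) hW
  exact ((continuousAt_const.add ((continuousAt_const.mul continuousAt_id).mul h3)).sub
    ((continuousAt_const.mul h2).mul (continuousAt_const.sub h3))).continuousWithinAt

lemma signTerm_eq {a x Y Z ρ : ℝ} (hx : 0 < x) (hY : 0 < Y) (hZ : 0 < Z) (hρ : 0 < ρ) :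
    signTerm a x Y Z ρ = 1 - Y * (ρ * ((x / Z * (ρ / (1 + Y * ρ)) ^ a - 1)
      * (1 / (1 + x * (1 + Y * ρ) ^ (-a))))) := by
  have hv : 0 < 1 + Y * ρ := by positivity
  have hW := one_add_mul_rpow_pos (a := a) hx hY hρ
  rw [signTerm, div_rpow hρ.le hv.le, rpow_add hρ, rpow_one]
  rw [rpow_neg hv.le] at *
  have hp : 0 < (1 + Y * ρ) ^ a := rpow_pos_of_pos hv _
  generalize (1 + Y * ρ) ^ a = p at *
  field_simp
  ring

lemma one_le_mul_div_rpow {a x Y Z ρ : ℝ} (ha : 0 < a) (hx : 0 < x) (hY : 0 < Y) (hZ : 0 < Z)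
    (hxZ : Y < (x / Z) ^ a⁻¹) (hρ : ((x / Z) ^ a⁻¹ - Y)⁻¹ ≤ ρ) :
    1 ≤ x / Z * (ρ / (1 + Y * ρ)) ^ a := by
  have hc : 0 < (x / Z) ^ a⁻¹ - Y := sub_pos.2 hxZ
  have hρ0 : 0 < ρ := (inv_pos.2 hc).trans_le hρ
  have hv : 0 < 1 + Y * ρ := by positivity
  have hq : 0 < x / Z := by positivity
  have h : 1 ≤ (x / Z) ^ a⁻¹ * (ρ / (1 + Y * ρ)) := by
    rw [← mul_div_assoc, one_le_div hv]
    have := (inv_le_iff_one_le_mul₀' hc).1 hρ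
    linarith
  have := one_le_rpow h ha.le
  rwa [mul_rpow (by positivity) (by positivity), ← rpow_mul hq.le, inv_mul_cancel₀ ha.ne',
    rpow_one] at this

lemma strictAntiOn_signTerm {a x Y Z : ℝ} (ha : 0 < a) (hx : 0 < x) (hY : 0 < Y) (hZ : 0 < Z)
    (hxZ : Y < (x / Z) ^ a⁻¹) :
    StrictAntiOn (signTerm a x Y Z) (Set.Ici ((x / Z) ^ a⁻¹ - Y)⁻¹) := by
  intro r hr s hs hrs
  have hr0 : 0 < r := (inv_pos.2 (sub_pos.2 hxZ)).trans_le hr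
  have hs0 : 0 < s := hr0.trans hrs
  have hv : 0 < 1 + Y * r := by positivity
  have hv' : 0 < 1 + Y * s := by positivity
  rw [signTerm_eq hx hY hZ hr0, signTerm_eq hx hY hZ hs0]
  have h1 := one_le_mul_div_rpow ha hx hY hZ hxZ hr
  have h2 : x / Z * (r / (1 + Y * r)) ^ a < x / Z * (s / (1 + Y * s)) ^ a := by
    refine mul_lt_mul_of_pos_left (rpow_lt_rpow (by positivity) ?_ ha) (by positivity)
    rw [div_lt_div_iff₀ hv hv']
    linarith
  have hWr := one_add_mul_rpow_pos (a := a) hx hY hr0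
  have hWs := one_add_mul_rpow_pos (a := a) hx hY hs0
  have h3 : 1 / (1 + x * (1 + Y * r) ^ (-a)) ≤ 1 / (1 + x * (1 + Y * s) ^ (-a)) := by
    refine one_div_le_one_div_of_le hWs ?_
    have := rpow_le_rpow_of_nonpos hv (by gcongr : 1 + Y * r ≤ 1 + Y * s) (neg_nonpos.2 ha.le)
    gcongr
  have h4 : (x / Z * (r / (1 + Y * r)) ^ a - 1) * (1 / (1 + x * (1 + Y * r) ^ (-a))) <
      (x / Z * (s / (1 + Y * s)) ^ a - 1) * (1 / (1 + x * (1 + Y * s) ^ (-a))) :=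
    mul_lt_mul (by linarith) h3 (one_div_pos.2 hWr) (by linarith)
  have h5 := mul_lt_mul'' hrs h4 hr0.le (mul_nonneg (by linarith) (one_div_pos.2 hWr).le)
  have := mul_lt_mul_of_pos_left h5 hY
  linarith

/-- Third case of Proposition 5 (equation (28), third branch): with the setup of the
sub-optimal design, `ρ_min < 1`, `G(ρ_min) ≥ 0`, and `G(1) < 0`, there is a unique
`ρ° ∈ [ρ_min, 1)` with `G(ρ°) = 0`; moreover `T` is monotonically increasing on
`[ρ_min, ρ°]` and strictly decreasing on `[ρ°, 1]`, so `ρ°` is the unique maximizer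
of `T` over `[ρ_min, 1]`. -/
theorem optimal_jamming_third_case
    (α δ : ℝ) (hα : 2 < α) (hδ : δ = 2 / α) (K : ℕ) (hK : 1 ≤ K)
    (X : Fin K → ℝ) (Y Z : ℝ) (hX : ∀ k, 0 < X k) (hY : 0 < Y) (hZ : 0 < Z)
    (hXZ : ∀ k, Y < (X k / Z) ^ δ)
    (ρmin : ℝ)
    (hρmin : IsGreatest (Set.range fun k => ((X k / Z) ^ δ - Y)⁻¹) ρmin)
    (hρmin1 : ρmin < 1)
    (T : ℝ → ℝ)
    (hT : ∀ ρ, T ρ = ∑ k, Real.log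
        ((1 + X k * (1 + Y * ρ) ^ (-(α / 2))) / (1 + Z * ρ ^ (-(α / 2)))))
    (κ : ℝ → ℝ)
    (hκ : ∀ ρ, κ ρ = ((K : ℝ))⁻¹ * ∑ k, 1 / (1 + X k * (1 + Y * ρ) ^ (-(α / 2))))
    (G : ℝ → ℝ)
    (hG : ∀ ρ, G ρ = 1 + Y * ρ * κ ρ - (Y / Z) * ρ ^ (α / 2 + 1) * (1 - κ ρ))
    (hGmin : 0 ≤ G ρmin) (hG1 : G 1 < 0) :
    ∃ ρ0 ∈ Set.Ico ρmin 1,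
      G ρ0 = 0
        ∧ (∀ ρ ∈ Set.Ico ρmin 1, G ρ = 0 → ρ = ρ0)
        ∧ MonotoneOn T (Set.Icc ρmin ρ0)
        ∧ StrictAntiOn T (Set.Icc ρ0 1)
        ∧ ∀ ρ ∈ Set.Icc ρmin 1, ρ ≠ ρ0 → T ρ < T ρ0 := by
  set a := α / 2 with ha_def
  have ha : 0 < a := by linarith
  have hδa : δ = a⁻¹ := by rw [hδ, ha_def, inv_div]
  simp only [hδa] at hXZ hρmin
  have hK0 : (0 : ℝ) < K := by exact_mod_cast hK
  have hmin : ∀ k, ((X k / Z) ^ a⁻¹ - Y)⁻¹ ≤ ρmin := fun k => hρmin.2 ⟨k, rfl⟩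
  have hpos : 0 < ρmin := by
    obtain ⟨k, hk⟩ := hρmin.1
    exact hk ▸ inv_pos.2 (sub_pos.2 (hXZ k))
  have hGsum : G = fun ρ => (K : ℝ)⁻¹ * ∑ k, signTerm a (X k) Y Z ρ := by
    funext ρ
    rw [hG, hκ]
    simp only [signTerm, Finset.sum_sub_distrib, Finset.sum_add_distrib, ← Finset.mul_sum,
      Finset.sum_const, Finset.card_univ, Fintype.card_fin, nsmul_eq_mul]
    generalize ∑ k, 1 / (1 + X k * (1 + Y * ρ) ^ (-a)) = S
    field_simp
  have hGanti : StrictAntiOn G (Set.Ici ρmin) := by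
    intro r hr s hs hrs
    rw [hGsum]
    refine mul_lt_mul_of_pos_left (Finset.sum_lt_sum_of_nonempty ⟨⟨0, hK⟩, Finset.mem_univ _⟩
      fun k _ => ?_) (inv_pos.2 hK0)
    exact strictAntiOn_signTerm ha (hX k) hY hZ (hXZ k) ((hmin k).trans hr) ((hmin k).trans hs) hrs
  have hGcont : ContinuousOn G (Set.Icc ρmin 1) := by
    rw [hGsum]
    refine continuousOn_const.mul (continuousOn_finsetSum _ fun k _ => ?_)
    exact (continuousOn_signTerm (hX k) hY).mono fun r hr => hpos.trans_le hr.1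
  have hTderiv : ∀ ρ, 0 < ρ → ∃ c, 0 < c ∧ HasDerivAt T (c * G ρ) ρ := by
    intro ρ hρ
    have hp : 0 < ρ ^ (-a - 1) := rpow_pos_of_pos hρ _
    have hq : 0 < ρ ^ (-a) := rpow_pos_of_pos hρ _
    refine ⟨K * (a * Z * ρ ^ (-a - 1) / ((1 + Y * ρ) * (1 + Z * ρ ^ (-a)))), by positivity, ?_⟩
    rw [funext hT, hGsum]
    refine (HasDerivAt.fun_sum fun k _ =>
      hasDerivAt_log_ratio (a := a) (hX k) hY hZ hρ).congr_deriv ?_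
    rw [← Finset.mul_sum]
    field_simp
  have hTcont : ContinuousOn T (Set.Ici ρmin) := fun ρ hρ =>
    let ⟨_, _, h⟩ := hTderiv ρ (hpos.trans_le hρ)
    h.continuousAt.continuousWithinAt
  obtain ⟨ρ0, hρ0, hzero⟩ := intermediate_value_Icc' hρmin1.le hGcont ⟨hG1.le, hGmin⟩
  have hlt : ρ0 < 1 := hρ0.2.lt_of_ne fun h => by rw [h] at hzero; exact hG1.ne hzero
  have hmono : StrictMonoOn T (Set.Icc ρmin ρ0) := by
    refine strictMonoOn_of_deriv_pos (convex_Icc _ _) (hTcont.mono fun r hr => hr.1) fun r hr => ?_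
    rw [interior_Icc] at hr
    obtain ⟨c, hc, h⟩ := hTderiv r (hpos.trans hr.1)
    rw [h.deriv]
    exact mul_pos hc (hzero ▸ hGanti hr.1.le hρ0.1 hr.2)
  have hanti : StrictAntiOn T (Set.Icc ρ0 1) := by
    refine strictAntiOn_of_deriv_neg (convex_Icc _ _)
      (hTcont.mono fun r hr => hρ0.1.trans hr.1) fun r hr => ?_
    rw [interior_Icc] at hr
    obtain ⟨c, hc, h⟩ := hTderiv r (hpos.trans_le (hρ0.1.trans hr.1.le))
    rw [h.deriv]
    exact mul_neg_of_pos_of_neg hc (hzero ▸ hGanti hρ0.1 (hρ0.1.trans hr.1.le) hr.1)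
  refine ⟨ρ0, ⟨hρ0.1, hlt⟩, hzero, fun r hr h => hGanti.injOn hr.1 hρ0.1 (h.trans hzero.symm),
    hmono.monotoneOn, hanti, fun r hr hne => ?_⟩
  rcases hne.lt_or_gt with h | h
  · exact hmono ⟨hr.1, h.le⟩ ⟨hρ0.1, le_rfl⟩ h
  · exact hanti ⟨le_rfl, hlt.le⟩ ⟨h.le, hr.2⟩ h
end
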